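/- Let n ≥ 1 and a ∈ L^∞S^{-n}_0. There is a constant C such that for every 0 < l < 1, every positive integer j with 2^j ≥ l^{-1}, every x_0 ∈ ℝⁿ, and every Schwartz function u: |Q(x_0,l)|^{-1} ∫_{Q(x_0,l)} |T_j^* u(x)| dx ≤ C 2^{−jn/2} l^{−n/2} Mu(x_0). -/

import Mathlib

open MeasureTheory Real
open scoped ENNReal NNReal InnerProductSpace BigOperators

noncomputable section

/-- `ℝⁿ` with its Euclidean structure. -/
abbrev Rn (n : ℕ) : Type := EuclideanSpace ℝ (Fin n)

/-- The Fourier transform `û(ξ) = ∫ e^{-i⟨x,ξ⟩} u(x) dx`. -/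
def ft {n : ℕ} (u : Rn n → ℂ) (ξ : Rn n) : ℂ :=
  ∫ x : Rn n, Complex.exp (-(Complex.I * ((⟪x, ξ⟫_ℝ : ℝ) : ℂ))) * u x

/-- The pseudo-differential operator `T_a u(x) = ∫ e^{i⟨x,ξ⟩} a(x,ξ) û(ξ) dξ`. -/
def pdo {n : ℕ} (a : Rn n → Rn n → ℂ) (u : Rn n → ℂ) (x : Rn n) : ℂ :=
  ∫ ξ : Rn n, Complex.exp (Complex.I * ((⟪x, ξ⟫_ℝ : ℝ) : ℂ)) * a x ξ * ft u ξ

/-- The dual operator `T_a^* u(x) = ∫∫ e^{i⟨x-y,ξ⟩} a(y,ξ) dξ u(y) dy`. -/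
def pdoDual {n : ℕ} (a : Rn n → Rn n → ℂ) (u : Rn n → ℂ) (x : Rn n) : ℂ :=
  ∫ y : Rn n,
    (∫ ξ : Rn n, Complex.exp (Complex.I * ((⟪x - y, ξ⟫_ℝ : ℝ) : ℂ)) * a y ξ) * u y

/-- The Hörmander symbol class `S^m_{ϱ,δ}`: `a` is smooth and
`|∂^β_x ∂^α_ξ a(x,ξ)| ≤ C_{α,β} (1+|ξ|²)^{(m-ϱ|α|+δ|β|)/2}`. -/
def HormClass {n : ℕ} (m ϱ δ : ℝ) (a : Rn n → Rn n → ℂ) : Prop :=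
  ContDiff ℝ (⊤ : ℕ∞) (Function.uncurry a) ∧
  ∀ k l : ℕ, ∃ C : ℝ, 0 < C ∧ ∀ x ξ : Rn n,
    ‖iteratedFDeriv ℝ l (fun y : Rn n => iteratedFDeriv ℝ k (fun η : Rn n => a y η) ξ) x‖ ≤
      C * (1 + ‖ξ‖ ^ 2) ^ ((m - ϱ * k + δ * l) / 2)

/-- The rough Hörmander class `L^∞S^m_ϱ`: `a(x,ξ)` is smooth in `ξ`, bounded measurable in `x`,
and `‖∂^α_ξ a(·,ξ)‖_{L^∞} ≤ C_α (1+|ξ|²)^{(m-ϱ|α|)/2}`. -/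
def RoughClass {n : ℕ} (m ϱ : ℝ) (a : Rn n → Rn n → ℂ) : Prop :=
  (∀ x : Rn n, ContDiff ℝ (⊤ : ℕ∞) (a x)) ∧
  (∀ ξ : Rn n, Measurable fun x : Rn n => a x ξ) ∧
  ∀ k : ℕ, ∃ C : ℝ, 0 < C ∧ ∀ ξ : Rn n, ∀ᵐ x : Rn n ∂volume,
    ‖iteratedFDeriv ℝ k (a x) ξ‖ ≤ C * (1 + ‖ξ‖ ^ 2) ^ ((m - ϱ * k) / 2)

/-- The axis-parallel cube centered at `x₀` with side length `l`. -/
def cube {n : ℕ} (x₀ : Rn n) (l : ℝ) : Set (Rn n) :=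
  {y | ∀ i, |y i - x₀ i| ≤ l / 2}

/-- The Hardy–Littlewood maximal function over axis-parallel cubes. -/
def mHL {n : ℕ} {E : Type*} [NormedAddCommGroup E] (u : Rn n → E) (x : Rn n) : ℝ≥0∞ :=
  ⨆ (x₀ : Rn n) (l : ℝ) (_ : 0 < l) (_ : x ∈ cube x₀ l),
    (∫⁻ y in cube x₀ l, (‖u y‖₊ : ℝ≥0∞)) / ENNReal.ofReal (l ^ n)

/-- The Fefferman–Stein sharp maximal function over axis-parallel cubes. -/
def mSharp {n : ℕ} (u : Rn n → ℂ) (x : Rn n) : ℝ≥0∞ :=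
  ⨆ (x₀ : Rn n) (l : ℝ) (_ : 0 < l) (_ : x ∈ cube x₀ l),
    ⨅ c : ℂ, (∫⁻ y in cube x₀ l, (‖u y - c‖₊ : ℝ≥0∞)) / ENNReal.ofReal (l ^ n)

/-- The Muckenhoupt `A₁` condition: `Mω ≤ C ω` a.e. -/
def IsA1 {n : ℕ} (ω : Rn n → ℝ) : Prop :=
  (∀ x, 0 ≤ ω x) ∧ LocallyIntegrable ω volume ∧
  ∃ C : ℝ, 0 < C ∧ ∀ᵐ x : Rn n ∂volume, mHL ω x ≤ ENNReal.ofReal (C * ω x)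

/-- The Muckenhoupt `A_p` condition for `1 < p < ∞`. -/
def IsAp {n : ℕ} (p : ℝ) (ω : Rn n → ℝ) : Prop :=
  (∀ x, 0 ≤ ω x) ∧ LocallyIntegrable ω volume ∧
  ∃ C : ℝ, 0 < C ∧ ∀ (x₀ : Rn n) (l : ℝ), 0 < l →
    ((∫⁻ y in cube x₀ l, ENNReal.ofReal (ω y)) / ENNReal.ofReal (l ^ n)) *
      (((∫⁻ y in cube x₀ l, ENNReal.ofReal (ω y ^ (1 / (1 - p)))) /
          ENNReal.ofReal (l ^ n)) ^ (p - 1))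
      ≤ ENNReal.ofReal C

/-- The weighted measure `ω(s) = ∫_s ω dx`. -/
def wMeas {n : ℕ} (ω : Rn n → ℝ) (s : Set (Rn n)) : ℝ≥0∞ :=
  ∫⁻ x in s, ENNReal.ofReal (ω x)

/-- The weighted `L¹` norm `∫ |u| ω dx`. -/
def wL1 {n : ℕ} (ω : Rn n → ℝ) (u : Rn n → ℂ) : ℝ≥0∞ :=
  ∫⁻ x : Rn n, (‖u x‖₊ : ℝ≥0∞) * ENNReal.ofReal (ω x)

/-- The weighted `L^p` norm `(∫ |u|^p ω dx)^{1/p}`. -/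
def wLp {n : ℕ} (p : ℝ) (ω : Rn n → ℝ) (u : Rn n → ℂ) : ℝ≥0∞ :=
  (∫⁻ x : Rn n, (‖u x‖₊ : ℝ≥0∞) ^ p * ENNReal.ofReal (ω x)) ^ (1 / p)

/-- A Littlewood–Paley cut-off: `ψ ∈ C_c^∞`, `0 ≤ ψ ≤ 1`, supported in the annulus
`{C₀⁻¹ ≤ |ξ| ≤ 2C₀}`. -/
def LPcut {n : ℕ} (C₀ : ℝ) (ψ : Rn n → ℝ) : Prop :=
  ContDiff ℝ (⊤ : ℕ∞) ψ ∧ HasCompactSupport ψ ∧ (∀ ξ, 0 ≤ ψ ξ) ∧ (∀ ξ, ψ ξ ≤ 1) ∧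
  tsupport ψ ⊆ {ξ : Rn n | C₀⁻¹ ≤ ‖ξ‖ ∧ ‖ξ‖ ≤ 2 * C₀}

/-- `K_j(x,y) = (2π)^{-n} ∫ e^{i⟨x-y,ξ⟩} a(x,ξ) ψ(2^{-j}ξ) dξ`. -/
def Kj {n : ℕ} (a : Rn n → Rn n → ℂ) (ψ : Rn n → ℝ) (j : ℕ) (x y : Rn n) : ℂ :=
  ((((2 * π) ^ n)⁻¹ : ℝ) : ℂ) *
    ∫ ξ : Rn n, Complex.exp (Complex.I * ((⟪x - y, ξ⟫_ℝ : ℝ) : ℂ)) * a x ξ *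
      ((ψ ((((2 : ℝ) ^ j)⁻¹) • ξ) : ℝ) : ℂ)

/-- `K_j^*(x,y) = (2π)^{-n} ∫ e^{i⟨x-y,ξ⟩} a(y,ξ) ψ(2^{-j}ξ) dξ`. -/
def KjStar {n : ℕ} (a : Rn n → Rn n → ℂ) (ψ : Rn n → ℝ) (j : ℕ) (x y : Rn n) : ℂ :=
  ((((2 * π) ^ n)⁻¹ : ℝ) : ℂ) *
    ∫ ξ : Rn n, Complex.exp (Complex.I * ((⟪x - y, ξ⟫_ℝ : ℝ) : ℂ)) * a y ξ *
      ((ψ ((((2 : ℝ) ^ j)⁻¹) • ξ) : ℝ) : ℂ)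

/-- `T_j u(x) = ∫ K_j(x,y) u(y) dy`. -/
def Tj {n : ℕ} (a : Rn n → Rn n → ℂ) (ψ : Rn n → ℝ) (j : ℕ) (u : Rn n → ℂ) (x : Rn n) : ℂ :=
  ∫ y : Rn n, Kj a ψ j x y * u y

/-- `T_j^* u(x) = ∫ K_j^*(x,y) u(y) dy`. -/
def TjStar {n : ℕ} (a : Rn n → Rn n → ℂ) (ψ : Rn n → ℝ) (j : ℕ) (u : Rn n → ℂ) (x : Rn n) : ℂ :=
  ∫ y : Rn n, KjStar a ψ j x y * u y

/-- The Fourier integral operator `T_{a,φ} u(x) = ∫ e^{iφ(x,ξ)} a(x,ξ) û(ξ) dξ`. -/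
def fio {n : ℕ} (a : Rn n → Rn n → ℂ) (φ : Rn n → Rn n → ℝ) (u : Rn n → ℂ) (x : Rn n) : ℂ :=
  ∫ ξ : Rn n, Complex.exp (Complex.I * ((φ x ξ : ℝ) : ℂ)) * a x ξ * ft u ξ

/-- The dual FIO `T^*_{a,φ} u(x) = ∫∫ e^{i(φ(y,ξ)-⟨x,ξ⟩)} a(y,ξ) dξ u(y) dy`. -/
def fioDual {n : ℕ} (a : Rn n → Rn n → ℂ) (φ : Rn n → Rn n → ℝ) (u : Rn n → ℂ) (x : Rn n) : ℂ :=
  ∫ y : Rn n,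
    (∫ ξ : Rn n, Complex.exp (Complex.I * ((φ y ξ - ⟪x, ξ⟫_ℝ : ℝ) : ℂ)) * a y ξ) * u y

/-- The phase class `Φ¹`: smooth on `ℝⁿ × (ℝⁿ∖{0})`, positively homogeneous of degree 1 in `ξ`,
with `sup |ξ|^{-1+|α|} |∂^α_ξ ∂^β_x φ| ≤ C_{α,β}` for `|α|+|β| ≥ 1`. -/
def Phi1 {n : ℕ} (φ : Rn n → Rn n → ℝ) : Prop :=
  ContDiffOn ℝ (⊤ : ℕ∞) (Function.uncurry φ) {p : Rn n × Rn n | p.2 ≠ 0} ∧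
  (∀ x : Rn n, ∀ ξ : Rn n, ξ ≠ 0 → ∀ t : ℝ, 0 < t → φ x (t • ξ) = t * φ x ξ) ∧
  ∀ k l : ℕ, 1 ≤ k + l → ∃ C : ℝ, 0 < C ∧ ∀ x ξ : Rn n, ξ ≠ 0 →
    ‖ξ‖ ^ ((k : ℝ) - 1) *
        ‖iteratedFDeriv ℝ k (fun η : Rn n => iteratedFDeriv ℝ l (fun y : Rn n => φ y η) x) ξ‖
      ≤ C

/-- The rough phase class `L^∞Φ¹`: positively homogeneous of degree 1 in `ξ`, smooth in `ξ` away
from the origin, bounded measurable in `x`, with `sup |ξ|^{-1+|α|} ‖∂^α_ξ φ(·,ξ)‖_{L^∞} ≤ C_α`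
for `|α| ≥ 1`. -/
def LinfPhi1 {n : ℕ} (φ : Rn n → Rn n → ℝ) : Prop :=
  (∀ x : Rn n, ContDiffOn ℝ (⊤ : ℕ∞) (φ x) {ξ : Rn n | ξ ≠ 0}) ∧
  (∀ ξ : Rn n, Measurable fun x : Rn n => φ x ξ) ∧
  (∀ ξ : Rn n, ∃ C : ℝ, ∀ x : Rn n, |φ x ξ| ≤ C) ∧
  (∀ x : Rn n, ∀ ξ : Rn n, ξ ≠ 0 → ∀ t : ℝ, 0 < t → φ x (t • ξ) = t * φ x ξ) ∧
  ∀ k : ℕ, 1 ≤ k → ∃ C : ℝ, 0 < C ∧ ∀ ξ : Rn n, ξ ≠ 0 → ∀ᵐ x : Rn n ∂volume,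
    ‖ξ‖ ^ ((k : ℝ) - 1) * ‖iteratedFDeriv ℝ k (φ x) ξ‖ ≤ C

open scoped SchwartzMap FourierTransform LineDeriv

lemma fourier_iterate_lineDerivOp_apply {n : ℕ} (f : 𝓢(Rn n, ℂ)) (m w : Rn n) (N : ℕ) :
    𝓕 ((∂_{m})^[N] f) w = (2 * π * Complex.I * (⟪w, m⟫_ℝ : ℝ)) ^ N * 𝓕 f w := by
  have hm : (inner ℝ · m : Rn n → ℝ).HasTemperateGrowth := by fun_prop
  induction N with
  | zero => simp
  | succ N ih =>
    rw [Function.iterate_succ_apply', SchwartzMap.fourier_lineDerivOp_eq]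
    simp only [smul_apply, SchwartzMap.smulLeftCLM_apply_apply hm, ih]
    simp only [smul_eq_mul, Complex.real_smul]
    ring

lemma norm_iterate_lineDerivOp_le {n : ℕ} (f : 𝓢(Rn n, ℂ)) (m x : Rn n) (hm : ‖m‖ = 1) (N : ℕ) :
    ‖(∂_{m})^[N] f x‖ ≤ ‖iteratedFDeriv ℝ N f x‖ := by
  rw [← LineDeriv.iteratedLineDerivOp_const_eq_iter_lineDerivOp,
    SchwartzMap.iteratedLineDerivOp_eq_iteratedFDeriv]
  simpa [hm] using (iteratedFDeriv ℝ N f x).le_opNorm (fun _ => m)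

lemma lintegral_enorm_fourier_sq {n : ℕ} (f : 𝓢(Rn n, ℂ)) :
    ∫⁻ w, ‖𝓕 f w‖ₑ ^ 2 = ∫⁻ x, ‖f x‖ₑ ^ 2 := by
  have key (g : 𝓢(Rn n, ℂ)) : ∫⁻ x, ‖g x‖ₑ ^ 2 = ENNReal.ofReal (∫ x, ‖g x‖ ^ 2) := by
    have hg : Integrable (fun x => ‖g x‖ ^ 2) := (g.memLp 2).integrable_norm_pow two_ne_zero
    rw [ofReal_integral_eq_lintegral_ofReal hg (.of_forall fun x => by positivity)]
    simp [ENNReal.ofReal_pow]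
  rw [key, key, SchwartzMap.integral_norm_sq_fourier]

lemma lintegral_comp_smul_eq {n : ℕ} {g : Rn n → ℝ≥0∞} (hg : Measurable g) {r : ℝ} (hr : r ≠ 0) :
    ∫⁻ z, g (r • z) = ENNReal.ofReal |(r ^ n)⁻¹| * ∫⁻ z, g z := by
  have h := Measure.map_addHaar_smul (volume : Measure (Rn n)) hr
  rw [← lintegral_map hg (measurable_const_smul r), h, lintegral_smul_measure]
  simp

/-- Up to normalization, the inverse Fourier transform `∫ e^{i⟨z,ξ⟩} f(ξ) dξ`. -/
def oscInt {n : ℕ} (f : Rn n → ℂ) (z : Rn n) : ℂ :=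
  ∫ ξ : Rn n, Complex.exp (Complex.I * ((⟪z, ξ⟫_ℝ : ℝ) : ℂ)) * f ξ

lemma oscInt_eq_fourier {n : ℕ} (f : 𝓢(Rn n, ℂ)) (z : Rn n) :
    oscInt f z = 𝓕 f ((-(2 * π)⁻¹ : ℝ) • z) := by
  rw [SchwartzMap.fourier_coe, Real.fourier_eq', oscInt]
  congr 1 with ξ
  rw [inner_smul_right, real_inner_comm, smul_eq_mul]
  congr 2
  push_cast
  have : (π : ℂ) ≠ 0 := by exact_mod_cast Real.pi_ne_zero
  field_simp

lemma enorm_pow_mul_oscInt {n : ℕ} (f : 𝓢(Rn n, ℂ)) (N : ℕ) (i : Fin n) (z : Rn n) :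
    ‖((z i : ℝ) : ℂ) ^ N * oscInt f z‖ₑ =
      ‖𝓕 ((∂_{(EuclideanSpace.single i (1 : ℝ) : Rn n)})^[N] f) ((-(2 * π)⁻¹ : ℝ) • z)‖ₑ := by
  rw [fourier_iterate_lineDerivOp_apply, oscInt_eq_fourier, enorm_mul, enorm_mul, enorm_pow,
    enorm_pow]
  congr 2
  rw [real_inner_comm, EuclideanSpace.inner_single_left]
  rw [← ofReal_norm, ← ofReal_norm]
  congr 1
  simp [abs_of_pos Real.pi_pos]
  have := Real.pi_ne_zero
  field_simp

lemma lintegral_pow_mul_oscInt_sq_le {n : ℕ} (f : 𝓢(Rn n, ℂ)) (N : ℕ) (i : Fin n) {B R : ℝ}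
    (hR : 0 ≤ R) (hB : ∀ ξ, ‖iteratedFDeriv ℝ N f ξ‖ ≤ B)
    (hs : tsupport f ⊆ Metric.closedBall 0 R) :
    ∫⁻ z : Rn n, ‖((z i : ℝ) : ℂ) ^ N * oscInt f z‖ₑ ^ 2 ≤
      ENNReal.ofReal ((2 * π) ^ n * B ^ 2 * R ^ n * volume.real (Metric.ball (0 : Rn n) 1)) := by
  have hB0 : 0 ≤ B := (norm_nonneg _).trans (hB 0)
  set e : Rn n := EuclideanSpace.single i (1 : ℝ)
  have he : ‖e‖ = 1 := by simp [e]
  have hr : (-(2 * π)⁻¹ : ℝ) ≠ 0 := by have := Real.pi_ne_zero; simp [this]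
  have hmeas : Measurable fun w => ‖𝓕 ((∂_{e})^[N] f) w‖ₑ ^ 2 :=
    (SchwartzMap.continuous _).enorm.measurable.pow_const 2
  have h1 : ∫⁻ x, ‖(∂_{e})^[N] f x‖ₑ ^ 2 ≤
      ENNReal.ofReal (B ^ 2) * volume (Metric.closedBall (0 : Rn n) R) := by
    rw [← setLIntegral_const, ← lintegral_indicator Metric.isClosed_closedBall.measurableSet]
    refine lintegral_mono fun x => ?_
    by_cases hx : x ∈ Metric.closedBall (0 : Rn n) R
    · rw [Set.indicator_of_mem hx, ENNReal.ofReal_pow hB0]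
      gcongr
      rw [← ofReal_norm]
      exact ENNReal.ofReal_le_ofReal ((norm_iterate_lineDerivOp_le f e x he N).trans (hB x))
    · have : iteratedFDeriv ℝ N f x = 0 := by
        by_contra h
        exact hx (hs (support_iteratedFDeriv_subset N h))
      have h0 : (∂_{e})^[N] f x = 0 := by
        simpa [this] using norm_iterate_lineDerivOp_le f e x he N
      simp [h0]
  calc _ = ∫⁻ z : Rn n, ‖𝓕 ((∂_{e})^[N] f) ((-(2 * π)⁻¹ : ℝ) • z)‖ₑ ^ 2 := by
        simp_rw [enorm_pow_mul_oscInt f N i]; rfl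
    _ = ENNReal.ofReal ((2 * π) ^ n) * ∫⁻ x, ‖(∂_{e})^[N] f x‖ₑ ^ 2 := by
        rw [lintegral_comp_smul_eq hmeas hr, lintegral_enorm_fourier_sq]
        congr 2
        rw [abs_inv, abs_pow, abs_neg, abs_of_pos (by positivity), inv_pow, inv_inv]
    _ ≤ ENNReal.ofReal ((2 * π) ^ n) *
          (ENNReal.ofReal (B ^ 2) * volume (Metric.closedBall (0 : Rn n) R)) := by gcongr
    _ = _ := by
        rw [Measure.addHaar_closedBall _ _ hR, ← ENNReal.ofReal_toReal (a := volume (Metric.ball _ _))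
          measure_ball_lt_top.ne, ← ENNReal.ofReal_mul (by positivity),
          ← ENNReal.ofReal_mul (by positivity), ← ENNReal.ofReal_mul (by positivity)]
        simp only [finrank_euclideanSpace, Fintype.card_fin, measureReal_def]
        congr 1
        ring

lemma exists_norm_iteratedFDeriv_le {n : ℕ} {g : Rn n → ℂ}
    (hg : HasCompactSupport g) (hg' : ContDiff ℝ (⊤ : ℕ∞) g) (k : ℕ) :
    ∃ M : ℝ, 0 ≤ M ∧ ∀ ξ, ‖iteratedFDeriv ℝ k g ξ‖ ≤ M := by
  obtain ⟨M, hM⟩ := (hg'.continuous_iteratedFDeriv (m := k)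
    (by exact_mod_cast le_top)).bounded_above_of_compact_support (hg.iteratedFDeriv k)
  exact ⟨M, (norm_nonneg _).trans (hM 0), hM⟩

lemma RoughClass.ae_forall_norm_le {n : ℕ} {m : ℝ} {a : Rn n → Rn n → ℂ}
    (ha : RoughClass m 0 a) (k : ℕ) :
    ∃ C : ℝ, 0 ≤ C ∧ ∀ᵐ y : Rn n, ∀ ξ,
      ‖iteratedFDeriv ℝ k (a y) ξ‖ ≤ C * (1 + ‖ξ‖ ^ 2) ^ (m / 2) := by
  obtain ⟨C, hC, h⟩ := ha.2.2 k
  refine ⟨C, hC.le, ?_⟩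
  obtain ⟨s, hs, hsd⟩ := TopologicalSpace.exists_countable_dense (Rn n)
  have h' := (ae_ball_iff hs).2 fun ξ _ => h ξ
  filter_upwards [h'] with y hy ξ
  have hcl : IsClosed {ξ | ‖iteratedFDeriv ℝ k (a y) ξ‖ ≤ C * (1 + ‖ξ‖ ^ 2) ^ (m / 2)} := by
    refine isClosed_le ((ha.1 y).continuous_iteratedFDeriv (by exact_mod_cast le_top)).norm ?_
    refine continuous_const.mul (Continuous.rpow_const (by fun_prop) fun ξ => .inl ?_)
    positivity
  refine hcl.closure_subset_iff.2 (fun ξ hξ => ?_) (hsd ξ)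
  simpa using hy ξ hξ

/-- The frequency localization `a_j(y,ξ) = a(y,ξ)ψ(2^{-j}ξ)`. -/
def locSymbol {n : ℕ} (a : Rn n → Rn n → ℂ) (ψ : Rn n → ℝ) (j : ℕ) (y ξ : Rn n) : ℂ :=
  a y ξ * ((ψ ((((2 : ℝ) ^ j)⁻¹) • ξ) : ℝ) : ℂ)

lemma tsupport_locSymbol_subset {n : ℕ} (a : Rn n → Rn n → ℂ) {C₀ : ℝ} {ψ : Rn n → ℝ}
    (hψ : LPcut C₀ ψ) (j : ℕ) (y : Rn n) :
    tsupport (locSymbol a ψ j y) ⊆ Metric.closedBall 0 (2 * C₀ * 2 ^ j) := by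
  refine closure_minimal (fun ξ hξ => ?_) Metric.isClosed_closedBall
  have h : ψ ((((2 : ℝ) ^ j)⁻¹) • ξ) ≠ 0 := by
    intro h
    simp [locSymbol, h] at hξ
  have h2 := (hψ.2.2.2.2 (subset_tsupport _ h)).2
  rw [norm_smul, norm_inv, norm_pow, Real.norm_ofNat, inv_mul_le_iff₀ (by positivity)] at h2
  rw [mem_closedBall_zero_iff]
  linarith

lemma contDiff_locSymbol {n : ℕ} {m : ℝ} {a : Rn n → Rn n → ℂ} (ha : RoughClass m 0 a)
    {C₀ : ℝ} {ψ : Rn n → ℝ} (hψ : LPcut C₀ ψ) (j : ℕ) (y : Rn n) :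
    ContDiff ℝ (⊤ : ℕ∞) (locSymbol a ψ j y) :=
  (ha.1 y).mul (Complex.ofRealCLM.contDiff.comp (hψ.1.comp (contDiff_const_smul _)))

lemma exists_norm_iteratedFDeriv_locSymbol_le {n : ℕ} {a : Rn n → Rn n → ℂ}
    (ha : RoughClass (-(n : ℝ)) 0 a) {C₀ : ℝ} (hC₀ : 1 < C₀) {ψ : Rn n → ℝ} (hψ : LPcut C₀ ψ)
    (N : ℕ) :
    ∃ B : ℝ, 0 ≤ B ∧ ∀ᵐ y : Rn n, ∀ j ξ,
      ‖iteratedFDeriv ℝ N (locSymbol a ψ j y) ξ‖ ≤ B * (((2 : ℝ) ^ j) ^ n)⁻¹ := by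
  have hψc : ContDiff ℝ (⊤ : ℕ∞) (fun ξ => (ψ ξ : ℂ)) := Complex.ofRealCLM.contDiff.comp hψ.1
  have hψs : HasCompactSupport (fun ξ => (ψ ξ : ℂ)) :=
    hψ.2.1.comp_left (g := ((↑) : ℝ → ℂ)) Complex.ofReal_zero
  choose M hM0 hM using exists_norm_iteratedFDeriv_le hψs hψc
  choose C hC0 hC using ha.ae_forall_norm_le
  refine ⟨∑ i ∈ Finset.range (N + 1), (N.choose i : ℝ) * (C i * C₀ ^ n) * M (N - i),
    Finset.sum_nonneg fun i _ => by
      have := hC0 i; have := hM0 (N - i); positivity, ?_⟩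
  filter_upwards [ae_all_iff.2 hC] with y hy j ξ
  have h2 : (0 : ℝ) < 2 ^ j := by positivity
  have hψj : ContDiff ℝ (⊤ : ℕ∞) (fun ξ => (ψ ((((2 : ℝ) ^ j)⁻¹) • ξ) : ℂ)) :=
    hψc.comp (contDiff_const_smul _)
  refine (norm_iteratedFDeriv_mul_le (ha.1 y) hψj ξ (n := N)
    (by exact_mod_cast le_top)).trans ?_
  rw [Finset.sum_mul]
  refine Finset.sum_le_sum fun i _ => ?_
  have hD := congrFun (iteratedFDeriv_comp_const_smul (𝕜 := ℝ) (i := N - i) (((2 : ℝ) ^ j)⁻¹)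
    (contDiff_infty.1 hψc (N - i))) ξ
  rw [hD]
  have hCi := hC0 i
  have hMi := hM0 (N - i)
  by_cases hξ : (((2 : ℝ) ^ j)⁻¹) • ξ ∈ tsupport ψ
  · have hlow := (hψ.2.2.2.2 hξ).1
    rw [norm_smul, norm_inv, norm_pow, Real.norm_ofNat] at hlow
    have hlow' : 2 ^ j / C₀ ≤ ‖ξ‖ := by
      rw [le_inv_mul_iff₀ h2] at hlow
      rwa [div_eq_mul_inv]
    have hpos : 0 < 2 ^ j / C₀ := by positivity
    have hw : (1 + ‖ξ‖ ^ 2) ^ (-(n : ℝ) / 2) ≤ C₀ ^ n * (((2 : ℝ) ^ j) ^ n)⁻¹ := by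
      calc (1 + ‖ξ‖ ^ 2) ^ (-(n : ℝ) / 2) ≤ ((2 ^ j / C₀) ^ 2) ^ (-(n : ℝ) / 2) := by
            refine Real.rpow_le_rpow_of_nonpos (by positivity) ?_ ?_
            · have : (2 ^ j / C₀) ^ 2 ≤ ‖ξ‖ ^ 2 := by gcongr
              linarith
            · have : (0 : ℝ) ≤ n := by positivity
              linarith
        _ = C₀ ^ n * (((2 : ℝ) ^ j) ^ n)⁻¹ := by
            rw [← Real.rpow_natCast (2 ^ j / C₀) 2, ← Real.rpow_mul hpos.le]
            rw [show ((2 : ℕ) : ℝ) * (-(n : ℝ) / 2) = -(n : ℝ) by push_cast; ring,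
              Real.rpow_neg hpos.le, Real.rpow_natCast, div_pow, inv_div, div_eq_mul_inv]
    have hψb : ‖(((2 : ℝ) ^ j)⁻¹) ^ (N - i) •
        iteratedFDeriv ℝ (N - i) (fun ξ => (ψ ξ : ℂ)) ((((2 : ℝ) ^ j)⁻¹) • ξ)‖ ≤ M (N - i) := by
      rw [norm_smul]
      refine (mul_le_of_le_one_left (norm_nonneg _) ?_).trans (hM _ _)
      rw [norm_pow, norm_inv, norm_pow, Real.norm_ofNat]
      exact pow_le_one₀ (by positivity) (inv_le_one_of_one_le₀ (one_le_pow₀ one_le_two))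
    calc _ ≤ (N.choose i : ℝ) * (C i * (C₀ ^ n * (((2 : ℝ) ^ j) ^ n)⁻¹)) * M (N - i) := by
          gcongr
          exact (hy i ξ).trans (by gcongr)
      _ = _ := by ring
  · have h0 : iteratedFDeriv ℝ (N - i) (fun ξ => (ψ ξ : ℂ)) ((((2 : ℝ) ^ j)⁻¹) • ξ) = 0 := by
      by_contra h
      have hmem := support_iteratedFDeriv_subset (𝕜 := ℝ) (N - i) h
      exact hξ (closure_mono (fun x hx => by simpa using hx) hmem)
    rw [h0, smul_zero, norm_zero, mul_zero]
    positivity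

lemma KjStar_eq {n : ℕ} (a : Rn n → Rn n → ℂ) (ψ : Rn n → ℝ) (j : ℕ) (x y : Rn n) :
    KjStar a ψ j x y =
      ((((2 * π) ^ n)⁻¹ : ℝ) : ℂ) * oscInt (locSymbol a ψ j y) (x - y) := by
  simp only [KjStar, oscInt, locSymbol, mul_assoc]

lemma measurable_KjStar {n : ℕ} {m : ℝ} {a : Rn n → Rn n → ℂ} (ha : RoughClass m 0 a)
    {C₀ : ℝ} {ψ : Rn n → ℝ} (hψ : LPcut C₀ ψ) (j : ℕ) :
    Measurable fun p : Rn n × Rn n => KjStar a ψ j p.1 p.2 := by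
  have hψm : Continuous ψ := hψ.1.continuous
  have ha' : Measurable fun q : Rn n × Rn n => a q.2 q.1 :=
    measurable_uncurry_of_continuous_of_measurable (u := fun ξ y => a y ξ)
      (fun y => (ha.1 y).continuous) ha.2.1
  have ha'' : Measurable fun q : (Rn n × Rn n) × Rn n => a q.1.2 q.2 :=
    ha'.comp (measurable_snd.prodMk (measurable_snd.comp measurable_fst))
  have he : Measurable fun q : (Rn n × Rn n) × Rn n =>
      Complex.exp (Complex.I * ((⟪q.1.1 - q.1.2, q.2⟫_ℝ : ℝ) : ℂ)) :=
    Continuous.measurable (by fun_prop)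
  have hp : Measurable fun q : (Rn n × Rn n) × Rn n => ((ψ ((((2 : ℝ) ^ j)⁻¹) • q.2) : ℝ) : ℂ) :=
    Continuous.measurable (by fun_prop)
  exact (((he.mul ha'').mul hp).stronglyMeasurable.integral_prod_right'
    (ν := volume)).measurable.const_mul _

lemma measurableSet_cube {n : ℕ} (x₀ : Rn n) (l : ℝ) : MeasurableSet (cube x₀ l) := by
  have : cube x₀ l = ⋂ i, {y : Rn n | |y i - x₀ i| ≤ l / 2} := by ext; simp [cube]
  rw [this]
  exact MeasurableSet.iInter fun i =>
    (isClosed_le (by fun_prop) continuous_const).measurableSet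

lemma volume_cube {n : ℕ} (x₀ : Rn n) {l : ℝ} (hl : 0 ≤ l) :
    volume (cube x₀ l) = ENNReal.ofReal (l ^ n) := by
  have : cube x₀ l = (WithLp.ofLp : Rn n → Fin n → ℝ) ⁻¹'
      (Set.univ.pi fun i => Set.Icc (x₀ i - l / 2) (x₀ i + l / 2)) := by
    ext y
    simp only [cube, Set.mem_ofPred_eq, Set.mem_preimage, Set.mem_univ_pi, Set.mem_Icc, abs_le]
    refine forall_congr' fun i => ?_
    constructor <;> rintro ⟨h1, h2⟩ <;> constructor <;> linarith
  rw [this, (PiLp.volume_preserving_ofLp (Fin n)).measure_preimage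
    (MeasurableSet.univ_pi fun i => measurableSet_Icc).nullMeasurableSet, volume_pi_pi]
  simp [Real.volume_Icc, ENNReal.ofReal_pow hl, add_sub_sub_cancel]

lemma lintegral_cube_le_mHL {n : ℕ} {E : Type*} [NormedAddCommGroup E] (u : Rn n → E)
    (x₀ : Rn n) {l : ℝ} (hl : 0 < l) :
    ∫⁻ y in cube x₀ l, ‖u y‖ₑ ≤ ENNReal.ofReal (l ^ n) * mHL u x₀ := by
  have h : (∫⁻ y in cube x₀ l, ‖u y‖ₑ) / ENNReal.ofReal (l ^ n) ≤ mHL u x₀ :=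
    le_iSup₂_of_le x₀ l <| le_iSup₂_of_le hl (fun i => by simp; positivity) le_rfl
  rw [ENNReal.div_le_iff (by simpa using pow_pos hl n) ENNReal.ofReal_ne_top] at h
  rwa [mul_comm]

lemma lintegral_cube_sub_le {n : ℕ} {h : Rn n → ℂ} (hm : Measurable h) {F : ℝ} (hF : 0 ≤ F)
    (hh : ∫⁻ z, ‖h z‖ₑ ^ 2 ≤ ENNReal.ofReal (F ^ 2)) (x₀ y : Rn n) {l : ℝ} (hl : 0 ≤ l) :
    ∫⁻ x in cube x₀ l, ‖h (x - y)‖ₑ ≤ ENNReal.ofReal (F * l ^ ((n : ℝ) / 2)) := by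
  have hm' : Measurable fun x => ‖h (x - y)‖ₑ := (hm.comp (measurable_id.sub_const y)).enorm
  have hpq : (2 : ℝ).HolderConjugate 2 := Real.HolderConjugate.two_two
  have key := ENNReal.lintegral_mul_le_Lp_mul_Lq (volume.restrict (cube x₀ l)) hpq
    hm'.aemeasurable (aemeasurable_const (b := (1 : ℝ≥0∞)))
  simp only [Pi.mul_apply, mul_one, lintegral_const, Measure.restrict_apply_univ,
    volume_cube x₀ hl, ENNReal.rpow_two, one_pow, one_mul] at key
  refine key.trans ?_
  have h1 : ∫⁻ x in cube x₀ l, ‖h (x - y)‖ₑ ^ 2 ≤ ENNReal.ofReal (F ^ 2) := by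
    refine (setLIntegral_le_lintegral _ _).trans ?_
    rwa [lintegral_sub_right_eq_self (fun x => ‖h x‖ₑ ^ 2) y]
  calc _ ≤ ENNReal.ofReal (F ^ 2) ^ (1 / 2 : ℝ) * ENNReal.ofReal (l ^ n) ^ (1 / 2 : ℝ) := by
        gcongr
    _ = _ := by
        rw [ENNReal.ofReal_rpow_of_nonneg (by positivity) (by positivity),
          ENNReal.ofReal_rpow_of_nonneg (by positivity) (by positivity),
          ← ENNReal.ofReal_mul (by positivity), ← Real.sqrt_eq_rpow, Real.sqrt_sq hF,
          ← Real.rpow_natCast l n, ← Real.rpow_mul hl, mul_one_div]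

/-- A kernel with bounded moments over a small cube has averages decaying like the sum of
normalized indicators of dyadic dilates of the unit cube. -/
lemma lintegral_cube_kernel_le_tsum {n : ℕ} {k : Rn n → ℂ} {x₀ y : Rn n} {l D : ℝ} (hl : l < 1)
    (N : ℕ) (hD : 0 ≤ D) (h0 : ∫⁻ x in cube x₀ l, ‖k (x - y)‖ₑ ≤ ENNReal.ofReal D)
    (hN : ∀ i, ∫⁻ x in cube x₀ l, ‖(((x - y) i : ℝ) : ℂ) ^ N * k (x - y)‖ₑ ≤ ENNReal.ofReal D) :
    ∫⁻ x in cube x₀ l, ‖k (x - y)‖ₑ ≤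
      ∑' m : ℕ, (cube x₀ (2 ^ (m + 1))).indicator
        (fun _ => ENNReal.ofReal (D * 4 ^ N * ((2 ^ m) ^ N)⁻¹)) y := by
  classical
  have hex : ∃ m : ℕ, y ∈ cube x₀ (2 ^ (m + 1)) := by
    obtain ⟨m, hm⟩ := pow_unbounded_of_one_lt (‖y - x₀‖) (one_lt_two (α := ℝ))
    refine ⟨m, fun i => ?_⟩
    have := PiLp.norm_apply_le (y - x₀) i
    rw [PiLp.sub_apply, Real.norm_eq_abs] at this
    rw [pow_succ]
    linarith
  let m := Nat.find hex
  refine le_trans ?_ (ENNReal.le_tsum m)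
  rw [Set.indicator_of_mem (Nat.find_spec hex)]
  by_cases hm : m = 0
  · refine h0.trans (ENNReal.ofReal_le_ofReal ?_)
    rw [hm]
    have : (1 : ℝ) ≤ 4 ^ N := one_le_pow₀ (by norm_num)
    simp only [pow_zero, one_pow, inv_one, mul_one]
    nlinarith
  · obtain ⟨p, hp⟩ := Nat.exists_eq_succ_of_ne_zero hm
    have hnot := Nat.find_min hex (m := p) (by change p < m; omega)
    simp only [cube, Set.mem_ofPred_eq, not_forall, not_le] at hnot
    obtain ⟨i, hi⟩ := hnot
    have h1p : (1 : ℝ) ≤ 2 ^ p := one_le_pow₀ one_le_two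
    have hle : ENNReal.ofReal ((2 ^ p / 2) ^ N) * ∫⁻ x in cube x₀ l, ‖k (x - y)‖ₑ ≤
        ENNReal.ofReal D := by
      rw [← lintegral_const_mul' _ _ ENNReal.ofReal_ne_top]
      refine le_trans (setLIntegral_mono' (measurableSet_cube x₀ l) fun x hx => ?_) (hN i)
      rw [enorm_mul]
      gcongr
      rw [← ofReal_norm, norm_pow, Complex.norm_real, Real.norm_eq_abs]
      refine ENNReal.ofReal_le_ofReal (pow_le_pow_left₀ (by positivity) ?_ N)
      have hxi := hx i
      have := abs_sub_abs_le_abs_sub (y i - x₀ i) (x i - x₀ i)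
      rw [show y i - x₀ i - (x i - x₀ i) = -((x - y) i) by rw [PiLp.sub_apply]; ring,
        abs_neg] at this
      rw [pow_succ] at hi
      linarith
    have hpos : (0 : ℝ) < (2 ^ p / 2) ^ N := by positivity
    rw [mul_comm, ← ENNReal.le_div_iff_mul_le (.inl (by simp))
      (.inl ENNReal.ofReal_ne_top), ← ENNReal.ofReal_div_of_pos hpos] at hle
    refine hle.trans (ENNReal.ofReal_le_ofReal (le_of_eq ?_))
    rw [hp, Nat.succ_eq_add_one, pow_succ, show (4 : ℝ) = 2 * 2 by norm_num]
    simp only [mul_pow, div_pow]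
    field_simp

lemma lintegral_tsum_indicator_cube_mul_le {n : ℕ} {E : Type*} [NormedAddCommGroup E]
    [MeasurableSpace E] [OpensMeasurableSpace E] {u : Rn n → E} (hu : Measurable u) (x₀ : Rn n)
    {D : ℝ} (hD : 0 ≤ D) :
    ∫⁻ y, (∑' m : ℕ, (cube x₀ (2 ^ (m + 1))).indicator
        (fun _ => ENNReal.ofReal (D * 4 ^ (n + 1) * ((2 ^ m) ^ (n + 1))⁻¹)) y) * ‖u y‖ₑ ≤
      ENNReal.ofReal (D * (4 ^ (n + 1) * 2 ^ n * 2)) * mHL u x₀ := by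
  have hterm (m : ℕ) : ∫⁻ y, (cube x₀ (2 ^ (m + 1))).indicator
        (fun _ => ENNReal.ofReal (D * 4 ^ (n + 1) * ((2 ^ m) ^ (n + 1))⁻¹)) y * ‖u y‖ₑ ≤
      ENNReal.ofReal (D * (4 ^ (n + 1) * 2 ^ n) * (1 / 2) ^ m) * mHL u x₀ := by
    rw [lintegral_congr fun y =>
      (Set.indicator_mul_left (cube x₀ (2 ^ (m + 1))) _ fun y => ‖u y‖ₑ).symm,
      lintegral_indicator (measurableSet_cube _ _), lintegral_const_mul _ hu.enorm]
    refine (mul_le_mul_right (lintegral_cube_le_mHL u x₀ (by positivity)) _).trans_eq ?_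
    rw [← mul_assoc, ← ENNReal.ofReal_mul (by positivity)]
    congr 2
    simp only [pow_succ, mul_pow, div_pow, one_pow]
    field_simp
  simp_rw [← ENNReal.tsum_mul_right]
  rw [lintegral_tsum (by
    exact fun m => ((measurable_const.indicator (measurableSet_cube _ _)).mul
      hu.enorm).aemeasurable)]
  refine (ENNReal.tsum_le_tsum hterm).trans_eq ?_
  rw [ENNReal.tsum_mul_right, ← ENNReal.ofReal_tsum_of_nonneg (fun m => by positivity)
    (summable_geometric_two.mul_left _), tsum_mul_left, tsum_geometric_two]
  congr 2
  ring

/-- If `a ∈ L^∞S^{-n}_0`, then for `0 < l < 1` and `j ≥ 1` with `2^j ≥ l⁻¹`: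
`|Q(x₀,l)|⁻¹ ∫_{Q(x₀,l)} |T_j^* u| dx ≤ C 2^{-jn/2} l^{-n/2} Mu(x₀)`. -/
theorem stmt11 (n : ℕ) (hn : 1 ≤ n)
    (a : Rn n → Rn n → ℂ) (ha : RoughClass (-(n : ℝ)) 0 a)
    (C₀ : ℝ) (hC₀ : 1 < C₀) (ψ : Rn n → ℝ) (hψ : LPcut C₀ ψ) :
    ∃ C : ℝ, 0 < C ∧ ∀ l : ℝ, 0 < l → l < 1 → ∀ j : ℕ, 1 ≤ j → l⁻¹ ≤ (2 : ℝ) ^ j →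
      ∀ x₀ : Rn n, ∀ u : SchwartzMap (Rn n) ℂ,
        (∫⁻ x in cube x₀ l, (‖TjStar a ψ j (⇑u) x‖₊ : ℝ≥0∞)) / ENNReal.ofReal (l ^ n) ≤
          ENNReal.ofReal (C * (2 : ℝ) ^ (-((j : ℝ) * n) / 2) * l ^ (-(n : ℝ) / 2)) *
            mHL (⇑u) x₀ := by
  obtain ⟨B₀, hB₀, hb₀⟩ := exists_norm_iteratedFDeriv_locSymbol_le ha hC₀ hψ 0
  obtain ⟨B₁, hB₁, hb₁⟩ := exists_norm_iteratedFDeriv_locSymbol_le ha hC₀ hψ (n + 1)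
  set B := max B₀ B₁
  set κ : ℝ := (2 * π) ^ n * B ^ 2 * (2 * C₀) ^ n * volume.real (Metric.ball (0 : Rn n) 1)
  have hκ : 0 ≤ κ := by positivity
  refine ⟨((2 * π) ^ n)⁻¹ * (√κ * (4 ^ (n + 1) * 2 ^ n * 2)) + 1, by positivity, ?_⟩
  intro l hl0 hl1 j _ _ x₀ u
  set F : ℝ := √κ * 2 ^ (-((j : ℝ) * n) / 2)
  have hF : 0 ≤ F := by positivity
  have hF2 : F ^ 2 = κ * ((2 ^ j) ^ n)⁻¹ := by
    rw [mul_pow, Real.sq_sqrt hκ, ← Real.rpow_natCast (2 ^ (-((j : ℝ) * n) / 2)) 2,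
      ← Real.rpow_mul zero_le_two, ← pow_mul, ← Real.rpow_natCast 2 (j * n),
      ← Real.rpow_neg zero_le_two]
    congr 2
    push_cast
    ring
  set D : ℝ := F * l ^ ((n : ℝ) / 2)
  have hD : 0 ≤ D := by positivity
  have hc : 0 ≤ ((2 * π) ^ n)⁻¹ := by positivity
  have hKm := measurable_KjStar ha hψ j
  have hker : ∀ᵐ y : Rn n, ∫⁻ x in cube x₀ l, ‖KjStar a ψ j x y‖ₑ ≤
      ENNReal.ofReal (((2 * π) ^ n)⁻¹) * ∑' m : ℕ, (cube x₀ (2 ^ (m + 1))).indicator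
        (fun _ => ENNReal.ofReal (D * 4 ^ (n + 1) * ((2 ^ m) ^ (n + 1))⁻¹)) y := by
    filter_upwards [hb₀, hb₁] with y hy₀ hy₁
    have hsupp := tsupport_locSymbol_subset a hψ j y
    let f : 𝓢(Rn n, ℂ) := HasCompactSupport.toSchwartzMap (f := locSymbol a ψ j y)
      ((isCompact_closedBall _ _).of_isClosed_subset (isClosed_tsupport _) hsupp)
      (contDiff_locSymbol ha hψ j y)
    have hmoment (N : ℕ) (i : Fin n) (hN : ∀ ξ, ‖iteratedFDeriv ℝ N f ξ‖ ≤ B * ((2 ^ j) ^ n)⁻¹) :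
        ∫⁻ x in cube x₀ l, ‖(((x - y) i : ℝ) : ℂ) ^ N * oscInt f (x - y)‖ₑ ≤
          ENNReal.ofReal D := by
      have hmeas : Measurable fun z : Rn n => ((z i : ℝ) : ℂ) ^ N * oscInt f z := by
        simp_rw [oscInt_eq_fourier]
        exact Continuous.measurable (by fun_prop)
      refine lintegral_cube_sub_le hmeas hF ?_ x₀ y hl0.le
      refine (lintegral_pow_mul_oscInt_sq_le f N i (by positivity) hN hsupp).trans_eq ?_
      rw [hF2]
      congr 1
      simp only [κ]
      rw [mul_pow, mul_pow (2 * C₀)]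
      field_simp
    simp_rw [KjStar_eq, enorm_mul]
    rw [lintegral_const_mul' _ _ enorm_ne_top, ← ofReal_norm (((_ : ℝ) : ℂ)), Complex.norm_real,
      Real.norm_of_nonneg hc]
    gcongr
    refine lintegral_cube_kernel_le_tsum hl1 (n + 1) hD ?_ fun i => hmoment (n + 1) i fun ξ =>
      (hy₁ j ξ).trans (by gcongr; exact le_max_right _ _)
    have h := hmoment 0 ⟨0, hn⟩ fun ξ => (hy₀ j ξ).trans (by gcongr; exact le_max_left _ _)
    simp only [pow_zero, one_mul] at h
    exact h
  have hmain : ∫⁻ x in cube x₀ l, ‖TjStar a ψ j u x‖ₑ ≤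
      ENNReal.ofReal (((2 * π) ^ n)⁻¹ * (D * (4 ^ (n + 1) * 2 ^ n * 2))) * mHL u x₀ := by
    calc _ ≤ ∫⁻ x in cube x₀ l, ∫⁻ y, ‖KjStar a ψ j x y‖ₑ * ‖u y‖ₑ := by
          gcongr with x
          simpa only [TjStar, enorm_mul] using
            enorm_integral_le_lintegral_enorm fun y => KjStar a ψ j x y * u y
      _ = ∫⁻ y, (∫⁻ x in cube x₀ l, ‖KjStar a ψ j x y‖ₑ) * ‖u y‖ₑ := by
          rw [lintegral_lintegral_swap (hKm.enorm.mul
            (u.continuous.measurable.comp measurable_snd).enorm).aemeasurable]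
          simp_rw [lintegral_mul_const' _ _ enorm_ne_top]
      _ ≤ ∫⁻ y, ENNReal.ofReal (((2 * π) ^ n)⁻¹) *
            ((∑' m : ℕ, (cube x₀ (2 ^ (m + 1))).indicator
              (fun _ => ENNReal.ofReal (D * 4 ^ (n + 1) * ((2 ^ m) ^ (n + 1))⁻¹)) y) *
              ‖u y‖ₑ) := by
          refine lintegral_mono_ae (hker.mono fun y hy => ?_)
          rw [← mul_assoc]
          gcongr
      _ ≤ _ := by
          rw [lintegral_const_mul' _ _ ENNReal.ofReal_ne_top, ENNReal.ofReal_mul hc,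
            mul_assoc (ENNReal.ofReal _)]
          gcongr
          exact lintegral_tsum_indicator_cube_mul_le u.continuous.measurable x₀ hD
  have hln : 0 < l ^ n := by positivity
  refine (ENNReal.div_le_iff (by simpa using hln) ENNReal.ofReal_ne_top).2 (hmain.trans ?_)
  rw [mul_right_comm (ENNReal.ofReal _), ← ENNReal.ofReal_mul (by positivity)]
  refine mul_le_mul' (ENNReal.ofReal_le_ofReal ?_) le_rfl
  have hl : l ^ (-(n : ℝ) / 2) * l ^ n = l ^ ((n : ℝ) / 2) := by
    rw [← Real.rpow_natCast l n, ← Real.rpow_add hl0]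
    congr 1
    ring
  rw [mul_assoc _ (l ^ (-(n : ℝ) / 2)) (l ^ n), hl]
  have hpos : (0 : ℝ) ≤ 2 ^ (-((j : ℝ) * n) / 2) * l ^ ((n : ℝ) / 2) := by positivity
  simp only [D, F]
  linarith
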